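/- arXiv:1709.09017 — 5 statements merged into one kernel-verified Lean document; each statement's English description precedes it below -/
import Mathlib

section
/- Let A, B, C be multiplicative characters of F_q, x ∈ F_q, and y ∈ F_q^* with y ≠ 1. Then F₁(A; B, ε; C; x, y) = −C(−1)·₂F₁(A, B; C; x) + ε(x)·BC̄(y)·ĀC(1−y)·B̄(y−x)·binom(AC̄, A)·binom(B, C) + (q−1)·C̄(y)·ĀC(y−1)·δ(y−x)·δ(B)·binom(C, A) + (q−1)·C̄(x)·BC̄(y)·ĀC(1−y)·B̄C(y−x)·δ(C). -/
open Finset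

namespace FFAppell

variable {F : Type*} [Field F] [Fintype F] [DecidableEq F]

/-- The multiplicative characters of a finite field form a finite type. -/
noncomputable instance : Fintype (MulChar F ℂ) := Fintype.ofFinite _

/-- The Jacobi sum `J(χ, λ) = Σ_{u ∈ F} χ(u)·λ(1−u)`. -/
noncomputable def J (χ lam : MulChar F ℂ) : ℂ := ∑ u : F, χ u * lam (1 - u)

/-- The binomial coefficient `binom(A, B) := B(−1)·J(A, B̄)`. -/
noncomputable def binom (A B : MulChar F ℂ) : ℂ := B (-1) * J A B⁻¹

/-- `δ(χ) = 1` if `χ` is the trivial character, `0` otherwise. -/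
noncomputable def δchar (χ : MulChar F ℂ) : ℂ := if χ = 1 then 1 else 0

/-- `δ(x) = 1` if `x = 0`, `0` otherwise. -/
def δ (x : F) : ℂ := if x = 0 then 1 else 0

/-- The finite-field Gauss hypergeometric function
`₂F₁(A, B; C; x) := ε(x)·BC(−1)·Σ_{y ∈ F} B(y)·B̄C(1−y)·Ā(1−xy)`,
where `ε = 1` is the trivial character (with `ε 0 = 0`). -/
noncomputable def twoF1 (A B C : MulChar F ℂ) (x : F) : ℂ :=
  (1 : MulChar F ℂ) x * (B * C) (-1) *
    ∑ y : F, B y * (B⁻¹ * C) (1 - y) * A⁻¹ (1 - x * y)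

/-- The finite-field `₃F₂` function:
`₃F₂(A₀,A₁,A₂; B₁,B₂; x) := (1/(q−1))·Σ_χ binom(A₀χ,χ)·binom(A₁χ,B₁χ)·binom(A₂χ,B₂χ)·χ(x)`. -/
noncomputable def threeF2 (A₀ A₁ A₂ B₁ B₂ : MulChar F ℂ) (x : F) : ℂ :=
  (1 / ((Fintype.card F : ℂ) - 1)) *
    ∑ χ : MulChar F ℂ, binom (A₀ * χ) χ * binom (A₁ * χ) (B₁ * χ) *
      binom (A₂ * χ) (B₂ * χ) * χ x

/-- The finite-field Appell function `F₁(A; B, B'; C; x, y)`: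
`ε(xy)·BB'(−1)·Σ_{u,v ∈ F} B(u)·B'(v)·(C·B̄·B̄')(1−u−v)·Ā(1−ux−vy)`. -/
noncomputable def AppellF1 (A B B' C : MulChar F ℂ) (x y : F) : ℂ :=
  (1 : MulChar F ℂ) (x * y) * (B * B') (-1) *
    ∑ u : F, ∑ v : F,
      B u * B' v * (C * B⁻¹ * B'⁻¹) (1 - u - v) * A⁻¹ (1 - u * x - v * y)

lemma char_neg_one_sq {K : Type*} [Field K] (χ : MulChar K ℂ) : χ (-1) * χ (-1) = 1 := by
  rw [← map_mul]; simp

lemma char_ne_zero {K : Type*} [Field K] (χ : MulChar K ℂ) {a : K} (ha : a ≠ 0) : χ a ≠ 0 :=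
  ((Ne.isUnit ha).map χ).ne_zero

lemma sum_comp_mul_left {K : Type*} [Field K] [Fintype K] (f : K → ℂ) {c : K}
    (hc : c ≠ 0) :
    ∑ u : K, f (c * u) = ∑ u : K, f u :=
  Equiv.sum_comp (Equiv.mulLeft₀ c hc) f

lemma sum_char_eq (χ : MulChar F ℂ) :
    ∑ u : F, χ u = ((Fintype.card F : ℂ) - 1) * δchar χ := by
  unfold δchar
  split_ifs with h
  · rw [h, MulChar.sum_one_eq_card_units, Fintype.card_units,
      Nat.cast_sub Fintype.card_pos]
    simp
  · rw [MulChar.sum_eq_zero_of_ne_one h, mul_zero]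

lemma char_inv {K : Type*} [Field K] (χ : MulChar K ℂ) (a : K) : χ a⁻¹ = (χ a)⁻¹ := by
  rw [← MulChar.inv_apply', MulChar.inv_apply_eq_inv']

lemma J_comm {K : Type*} [Field K] [Fintype K] (χ ψ : MulChar K ℂ) : J χ ψ = J ψ χ :=
  jacobiSum_comm χ ψ

/-- The transformation `u ↦ u / (u - 1)` of a Jacobi sum. -/
lemma J_eq_mul_J_inv (χ ψ : MulChar F ℂ) :
    J χ ψ = χ (-1) * J χ (χ * ψ)⁻¹ := by
  rw [J_comm χ ψ, J_comm χ]
  unfold J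
  rw [← Equiv.sum_comp (Equiv.inv F), Finset.mul_sum]
  refine Finset.sum_congr rfl fun w _ => ?_
  simp only [Equiv.inv_apply]
  by_cases hw : w = 0
  · simp [hw, MulChar.map_zero]
  · have h : (1 : F) - w⁻¹ = (-1) * (1 - w) * w⁻¹ := by field_simp; ring
    rw [h, map_mul, map_mul, MulChar.inv_apply', MulChar.mul_apply]
    ring

/-- The double sum splits according to whether `s + t` vanishes. -/
lemma sum_sum_char_one_add (A B D : MulChar F ℂ) :
    ∑ s : F, ∑ t : F, B s * D t * A (1 + s + t) =
      (B * D) (-1) * J (B * D) A * J B D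
        + D (-1) * (((Fintype.card F : ℂ) - 1) * δchar (B * D)) := by
  have h1 : ∑ s : F, ∑ t : F, B s * D t * A (1 + s + t) =
      ∑ r : F, A (1 + r) * ∑ s : F, B s * D (r - s) := by
    simp_rw [Finset.mul_sum]
    rw [Finset.sum_comm (s := univ (α := F)) (f := fun r s => A (1 + r) * (B s * D (r - s)))]
    refine Finset.sum_congr rfl fun s _ => ?_
    rw [← Equiv.sum_comp (Equiv.addLeft s) (fun r => A (1 + r) * (B s * D (r - s)))]
    refine Finset.sum_congr rfl fun t _ => ?_
    simp only [Equiv.coe_addLeft, add_sub_cancel_left, add_assoc]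
    ring
  have h2 (r : F) : ∑ s : F, B s * D (r - s) = (B * D) r * J B D +
      if r = 0 then D (-1) * (((Fintype.card F : ℂ) - 1) * δchar (B * D)) else 0 := by
    split_ifs with hr
    · rw [hr, MulChar.map_zero, zero_mul, zero_add, ← sum_char_eq, Finset.mul_sum]
      refine Finset.sum_congr rfl fun s _ => ?_
      rw [zero_sub, neg_eq_neg_one_mul, map_mul, MulChar.mul_apply]
      ring
    · rw [add_zero, ← sum_comp_mul_left _ hr, J, Finset.mul_sum]
      refine Finset.sum_congr rfl fun s _ => ?_
      rw [show r - r * s = r * (1 - s) by ring, map_mul, map_mul, MulChar.mul_apply]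
      ring
  have h3 : ∑ r : F, A (1 + r) * (B * D) r = (B * D) (-1) * J (B * D) A := by
    rw [← Equiv.sum_comp (Equiv.neg F), J, Finset.mul_sum]
    refine Finset.sum_congr rfl fun r _ => ?_
    rw [Equiv.neg_apply, neg_eq_neg_one_mul, map_mul, show 1 + -1 * r = 1 - r by ring]
    ring
  rw [h1]
  simp_rw [h2, mul_add, ← mul_assoc]
  rw [Finset.sum_add_distrib, ← Finset.sum_mul, h3]
  simp

lemma binom_mul_binom (A B C : MulChar F ℂ) :
    binom (A * C⁻¹) A * binom B C =
      (B * C) (-1) * J C A⁻¹ * J B (C * B⁻¹) := by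
  rw [J_eq_mul_J_inv B, J_comm C, J_eq_mul_J_inv A⁻¹, J_comm A⁻¹,
    show B * (C * B⁻¹) = C by rw [mul_comm C, mul_inv_cancel_left],
    show (A⁻¹ * C)⁻¹ = A * C⁻¹ by rw [mul_inv, inv_inv], MulChar.inv_apply', inv_neg, inv_one,
    MulChar.mul_apply, binom, binom]
  linear_combination (-(A (-1) * C (-1) * J (A * C⁻¹) A⁻¹ * J B C⁻¹)) * char_neg_one_sq B

/-- Completing the `v`-sum and changing variables to `w = 1 - u - v`. -/
lemma appellF1_one_right (A B C : MulChar F ℂ) {x y : F} (hx : x ≠ 0) (hy : y ≠ 0) :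
    AppellF1 A B 1 C x y = -(C (-1)) * twoF1 A B C x +
      B (-1) * ∑ u : F, ∑ w : F,
        B u * (C * B⁻¹) w * A⁻¹ (1 - y + u * (y - x) + w * y) := by
  have h1 (u : F) : ∑ v : F, B u * (1 : MulChar F ℂ) v * (C * B⁻¹) (1 - u - v) *
        A⁻¹ (1 - u * x - v * y) =
      (∑ w : F, B u * (C * B⁻¹) w * A⁻¹ (1 - y + u * (y - x) + w * y)) -
        B u * (B⁻¹ * C) (1 - u) * A⁻¹ (1 - x * u) := by
    rw [← Equiv.sum_comp (Equiv.subLeft (1 - u))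
      (fun w => B u * (C * B⁻¹) w * A⁻¹ (1 - y + u * (y - x) + w * y)), eq_sub_iff_add_eq,
      ← Finset.add_sum_erase _ _ (Finset.mem_univ (0 : F)),
      ← Finset.add_sum_erase _ _ (Finset.mem_univ (0 : F)), MulChar.map_zero, add_right_comm]
    congr 1
    · simp only [Equiv.subLeft_apply, sub_zero, mul_zero, zero_mul, zero_add]
      rw [mul_comm C, show 1 - y + u * (y - x) + (1 - u) * y = 1 - x * u by ring]
    · refine Finset.sum_congr rfl fun v hv => ?_
      rw [MulChar.one_apply (Ne.isUnit (Finset.ne_of_mem_erase hv)), Equiv.subLeft_apply,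
        show 1 - y + u * (y - x) + (1 - u - v) * y = 1 - u * x - v * y by ring, mul_one]
  rw [AppellF1, twoF1, inv_one, mul_one, mul_one, MulChar.one_apply (Ne.isUnit (mul_ne_zero hx hy)),
    MulChar.one_apply (Ne.isUnit hx)]
  simp_rw [h1]
  rw [Finset.sum_sub_distrib, MulChar.mul_apply]
  linear_combination (B (-1) * ∑ u : F, B u * (B⁻¹ * C) (1 - u) * A⁻¹ (1 - x * u)) *
    char_neg_one_sq C

/-- The completed double sum when `y = x`. -/
lemma sum_sum_of_eq (A B C : MulChar F ℂ) {y : F} (hy0 : y ≠ 0) (hy1 : y ≠ 1) :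
    B (-1) * ∑ u : F, ∑ w : F, B u * (C * B⁻¹) w * A⁻¹ (1 - y + w * y) =
      ((Fintype.card F : ℂ) - 1) * C⁻¹ y * (A⁻¹ * C) (y - 1) * δchar B * binom C A := by
  have h : ∑ u : F, ∑ w : F, B u * (C * B⁻¹) w * A⁻¹ (1 - y + w * y) =
      (∑ u : F, B u) * ∑ w : F, (C * B⁻¹) w * A⁻¹ (1 - y + w * y) := by
    rw [Finset.sum_mul_sum]
    simp_rw [mul_assoc]
  rw [h, sum_char_eq]
  by_cases hB : B = 1
  · have hc : (y - 1) * y⁻¹ ≠ 0 := mul_ne_zero (sub_ne_zero.mpr hy1) (inv_ne_zero hy0)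
    have h2 : ∑ w : F, C w * A⁻¹ (1 - y + w * y) =
        C⁻¹ y * (A⁻¹ * C) (y - 1) * binom C A := by
      rw [← sum_comp_mul_left _ hc, binom, J, Finset.mul_sum, Finset.mul_sum]
      refine Finset.sum_congr rfl fun w _ => ?_
      rw [show 1 - y + (y - 1) * y⁻¹ * w * y = -1 * (y - 1) * (1 - w) by field_simp; ring]
      simp only [map_mul, MulChar.mul_apply]
      rw [MulChar.inv_apply' C, MulChar.inv_apply' A (-1), inv_neg, inv_one]
      ring
    rw [hB, inv_one, mul_one, h2, MulChar.one_apply isUnit_one.neg]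
    ring
  · simp [δchar, hB]

/-- The completed double sum when `y ≠ x`. -/
lemma sum_sum_of_ne (A B C : MulChar F ℂ) {x y : F} (hx : x ≠ 0) (hy0 : y ≠ 0)
    (hy1 : y ≠ 1) (hxy : y - x ≠ 0) :
    B (-1) * ∑ u : F, ∑ w : F, B u * (C * B⁻¹) w * A⁻¹ (1 - y + u * (y - x) + w * y) =
      (B * C⁻¹) y * (A⁻¹ * C) (1 - y) * B⁻¹ (y - x) * binom (A * C⁻¹) A * binom B C
      + ((Fintype.card F : ℂ) - 1) * C⁻¹ x * (B * C⁻¹) y * (A⁻¹ * C) (1 - y) *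
          (B⁻¹ * C) (y - x) * δchar C := by
  have hz : 1 - y ≠ 0 := sub_ne_zero.mpr hy1.symm
  have h : ∑ u : F, ∑ w : F, B u * (C * B⁻¹) w * A⁻¹ (1 - y + u * (y - x) + w * y) =
      (B * C⁻¹) y * (A⁻¹ * C) (1 - y) * B⁻¹ (y - x) *
        ∑ s : F, ∑ t : F, B s * (C * B⁻¹) t * A⁻¹ (1 + s + t) := by
    rw [← sum_comp_mul_left _ (mul_ne_zero hz (inv_ne_zero hxy)), Finset.mul_sum]
    refine Finset.sum_congr rfl fun s _ => ?_
    rw [← sum_comp_mul_left _ (mul_ne_zero hz (inv_ne_zero hy0)), Finset.mul_sum]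
    refine Finset.sum_congr rfl fun t _ => ?_
    rw [show 1 - y + (1 - y) * (y - x)⁻¹ * s * (y - x) + (1 - y) * y⁻¹ * t * y =
      (1 - y) * (1 + s + t) by field_simp]
    simp only [map_mul, MulChar.mul_apply, MulChar.inv_apply_eq_inv', char_inv]
    have := char_ne_zero B hz
    have := char_ne_zero B hy0
    have := char_ne_zero B hxy
    field_simp
  have hC : C⁻¹ x * (B⁻¹ * C) (y - x) * δchar C = B⁻¹ (y - x) * δchar C := by
    by_cases hC : C = 1
    · simp [hC, MulChar.one_apply (Ne.isUnit hx)]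
    · simp [δchar, hC]
  have hC' : C (-1) * δchar C = δchar C := by
    by_cases hC : C = 1
    · simp [hC, MulChar.one_apply (isUnit_one.neg)]
    · simp [δchar, hC]
  have hB : B⁻¹ (-1) = B (-1) := by rw [MulChar.inv_apply', inv_neg, inv_one]
  rw [h, sum_sum_char_one_add, show B * (C * B⁻¹) = C by rw [mul_comm C, mul_inv_cancel_left],
    mul_assoc _ (binom (A * C⁻¹) A), binom_mul_binom, MulChar.mul_apply C, hB,
    MulChar.mul_apply B C (-1)]
  set P := (B * C⁻¹) y * (A⁻¹ * C) (1 - y)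
  linear_combination
    (-(((Fintype.card F : ℂ) - 1) * P)) * hC
    + (((Fintype.card F : ℂ) - 1) * P * B⁻¹ (y - x)) * hC'
    + (((Fintype.card F : ℂ) - 1) * P * B⁻¹ (y - x) * C (-1) * δchar C) * char_neg_one_sq B

/-- Theorem 3.2: reduction formula for `F₁(A; B, ε; C; x, y)` with `y ∈ F_q^* \ {1}`. -/
theorem appellF1_reduction_right_trivial (A B C : MulChar F ℂ) (x y : F)
    (hy0 : y ≠ 0) (hy1 : y ≠ 1) :
    AppellF1 A B (1 : MulChar F ℂ) C x y =
      -(C (-1)) * twoF1 A B C x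
      + (1 : MulChar F ℂ) x * (B * C⁻¹) y * (A⁻¹ * C) (1 - y) * B⁻¹ (y - x) *
          binom (A * C⁻¹) A * binom B C
      + ((Fintype.card F : ℂ) - 1) * C⁻¹ y * (A⁻¹ * C) (y - 1) * δ (y - x) * δchar B *
          binom C A
      + ((Fintype.card F : ℂ) - 1) * C⁻¹ x * (B * C⁻¹) y * (A⁻¹ * C) (1 - y) *
          (B⁻¹ * C) (y - x) * δchar C := by
  by_cases hx : x = 0
  · by_cases hC : C = 1
    · simp [AppellF1, twoF1, hx, hC, hy0, MulChar.map_zero, δ]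
    · simp [AppellF1, twoF1, hx, hC, hy0, MulChar.map_zero, δ, δchar]
  rw [appellF1_one_right A B C hx hy0, MulChar.one_apply (Ne.isUnit hx)]
  by_cases hxy : y = x
  · subst hxy
    have h := sum_sum_of_eq A B C hy0 hy1
    simp only [sub_self, mul_zero, add_zero, MulChar.map_zero, zero_mul, δ, if_true, mul_one]
    rw [h]
  · have hsub : y - x ≠ 0 := sub_ne_zero.mpr hxy
    rw [sum_sum_of_ne A B C hx hy0 hy1 hsub]
    simp only [δ, hsub, if_false]
    ring

end FFAppell
end

section
/- For any multiplicative characters A, B, C of F_q, the finite-field Gauss hypergeometric function evaluated at 1 satisfies ₂F₁(A, B; C; 1) = A(−1)·binom(B, ĀC). -/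
open Finset

namespace FFAppell

variable {F : Type*} [Field F] [Fintype F] [DecidableEq F]

/-- The Jacobi sum transforms under the involution `u ↦ u / (u - 1)` of `F ∖ {1}`. -/
theorem J_eq_mul_J_inv_mul_inv (χ lam : MulChar F ℂ) :
    J χ lam = χ (-1) * J χ (χ⁻¹ * lam⁻¹) := by
  have drop (ψ : MulChar F ℂ) : J χ ψ = ∑ u with u ≠ 1, χ u * ψ (1 - u) := by
    rw [J, Finset.sum_filter_of_ne]
    rintro u - hu rfl
    simp [MulChar.map_zero] at hu
  rw [drop, drop, Finset.mul_sum]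
  have ne_one (u : F) (hu : u ≠ 1) : u / (u - 1) ≠ 1 := by
    have h : u - 1 ≠ 0 := sub_ne_zero.mpr hu
    rw [Ne, div_eq_one_iff_eq h]
    intro h'
    simpa using congrArg (u - ·) h'
  have invol (u : F) (hu : u ≠ 1) : u / (u - 1) / (u / (u - 1) - 1) = u := by
    have h : u - 1 ≠ 0 := sub_ne_zero.mpr hu
    have h' : u / (u - 1) - 1 = (u - 1)⁻¹ := by
      field_simp
      ring
    rw [h', div_inv_eq_mul, div_mul_cancel₀ _ h]
  refine Finset.sum_nbij' (fun u ↦ u / (u - 1)) (fun u ↦ u / (u - 1)) ?_ ?_ ?_ ?_ ?_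
  · simpa using ne_one
  · simpa using ne_one
  · simpa using invol
  · simpa using invol
  · intro u hu
    have hu1 : u ≠ 1 := by simpa using hu
    have h : u - 1 ≠ 0 := sub_ne_zero.mpr hu1
    have h' : 1 - u ≠ 0 := sub_ne_zero.mpr hu1.symm
    have h1 : (1 - u / (u - 1))⁻¹ = 1 - u := by
      rw [inv_eq_iff_eq_inv]
      field_simp
      ring
    have h2 : -1 * (u / (u - 1)) * (1 - u) = u := by
      field_simp
      ring
    rw [MulChar.mul_apply, MulChar.inv_apply', MulChar.inv_apply', h1]
    nth_rewrite 1 [← h2]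
    rw [map_mul, map_mul]
    ring

/-- Greene's evaluation of `₂F₁` at `1`: `₂F₁(A, B; C; 1) = A(−1)·binom(B, ĀC)`. -/
theorem twoF1_at_one (A B C : MulChar F ℂ) :
    twoF1 A B C 1 = A (-1) * binom B (A⁻¹ * C) := by
  have hJ : twoF1 A B C 1 = (B * C) (-1) * J B (B⁻¹ * C * A⁻¹) := by
    simp only [twoF1, J, map_one, one_mul, MulChar.mul_apply, mul_assoc]
  have sq (χ : MulChar F ℂ) : χ (-1) * χ (-1) = 1 := by rw [← map_mul]; simp
  have hA : A⁻¹ (-1) = A (-1) := by rw [MulChar.inv_apply']; simp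
  have hchar : B⁻¹ * (B⁻¹ * C * A⁻¹)⁻¹ = (A⁻¹ * C)⁻¹ := by
    simp only [mul_inv, inv_inv]
    rw [mul_assoc, inv_mul_cancel_left, mul_comm]
  rw [hJ, J_eq_mul_J_inv_mul_inv, hchar, binom, MulChar.mul_apply, MulChar.mul_apply, hA]
  linear_combination C (-1) * J B (A⁻¹ * C)⁻¹ * (sq B - sq A)

end FFAppell
end

section
/- (Finite-field binomial theorem.) For any multiplicative character A of F_q and any x ∈ F_q, one has A(1+x) = δ(x) + (1/(q−1))·Σ_χ binom(A, χ)·χ(x), where the sum ranges over all multiplicative characters χ of F_q. -/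
open Finset

namespace FFAppell

variable {F : Type*} [Field F] [Fintype F] [DecidableEq F]

/-- Orthogonality of the multiplicative characters of a finite field, summed over characters. -/
theorem sum_mulChar_apply (a : F) :
    ∑ χ : MulChar F ℂ, χ a = if a = 1 then (Fintype.card F : ℂ) - 1 else 0 := by
  have : NeZero (Monoid.exponent Fˣ) := ⟨Monoid.exponent_ne_zero_of_finite⟩
  split_ifs with ha
  · have hcard : Fintype.card (MulChar F ℂ) = Fintype.card F - 1 := by
      rw [← Fintype.card_units, ← Nat.card_eq_fintype_card, ← Nat.card_eq_fintype_card]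
      exact MulChar.card_eq_card_units_of_hasEnoughRootsOfUnity F ℂ
    simp [ha, hcard, Nat.cast_sub (Fintype.card_pos (α := F))]
  · obtain ⟨ψ, hψ⟩ := MulChar.exists_apply_ne_one_of_hasEnoughRootsOfUnity F ℂ ha
    refine eq_zero_of_mul_eq_self_left hψ ?_
    simp only [Finset.mul_sum, ← MulChar.mul_apply]
    exact Fintype.sum_bijective _ (Group.mulLeft_bijective ψ) _ _ fun _ ↦ rfl

/-- The finite-field binomial theorem:
`A(1+x) = δ(x) + (1/(q−1))·Σ_χ binom(A, χ)·χ(x)`. -/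
theorem binomial_theorem (A : MulChar F ℂ) (x : F) :
    A (1 + x) = δ x + (1 / ((Fintype.card F : ℂ) - 1)) *
      ∑ χ : MulChar F ℂ, binom A χ * χ x := by
  by_cases hx : x = 0
  · simp [hx, δ, MulChar.map_zero]
  have hq : (Fintype.card F : ℂ) - 1 ≠ 0 :=
    sub_ne_zero.mpr (by exact_mod_cast (Fintype.one_lt_card (α := F)).ne')
  have hinv (u : F) : -x * (1 - u)⁻¹ = 1 ↔ u = 1 + x := by
    constructor
    · intro h
      have hu : 1 - u ≠ 0 := by
        intro hu
        simp [hu] at h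
      rw [mul_inv_eq_one₀ hu] at h
      linear_combination h
    · rintro rfl
      rw [show 1 - (1 + x) = -x by ring, mul_inv_cancel₀ (neg_ne_zero.mpr hx)]
  have hsum : ∑ χ : MulChar F ℂ, binom A χ * χ x = A (1 + x) * ((Fintype.card F : ℂ) - 1) := by
    calc ∑ χ : MulChar F ℂ, binom A χ * χ x
        = ∑ χ : MulChar F ℂ, ∑ u : F, A u * χ (-x * (1 - u)⁻¹) := by
          refine Finset.sum_congr rfl fun χ _ ↦ ?_
          rw [binom, J, Finset.mul_sum, Finset.sum_mul]
          refine Finset.sum_congr rfl fun u _ ↦ ?_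
          rw [MulChar.inv_apply', map_mul, neg_eq_neg_one_mul x, map_mul]
          ring
      _ = ∑ u : F, A u * ∑ χ : MulChar F ℂ, χ (-x * (1 - u)⁻¹) := by
          rw [Finset.sum_comm]
          simp only [Finset.mul_sum]
      _ = A (1 + x) * ((Fintype.card F : ℂ) - 1) := by
          simp only [sum_mulChar_apply, hinv, mul_ite, mul_zero, Finset.sum_ite_eq',
            Finset.mem_univ, if_true]
  rw [hsum, δ, if_neg hx]
  field_simp
  ring

end FFAppell
end

section
/- For any multiplicative characters A, C of F_q and any x ∈ F_q, one has ₂F₁(A, ε; C; x) = binom(C, A)·A(−1)·C̄(x)·ĀC(1−x) − C(−1)·ε(x) + (q−1)·A(−1)·δ(1−x)·δ(ĀC). -/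
open Finset

namespace FFAppell

variable {F : Type*} [Field F] [Fintype F] [DecidableEq F]

omit [Fintype F] [DecidableEq F] in
theorem mulChar_neg_one_mul_self (χ : MulChar F ℂ) : χ (-1) * χ (-1) = 1 := by
  rw [← map_mul, neg_one_mul, neg_neg, map_one]

theorem mulChar_sum_eq_δchar (χ : MulChar F ℂ) :
    ∑ y : F, χ y = ((Fintype.card F : ℂ) - 1) * δchar χ := by
  unfold δchar
  split_ifs with h
  · rw [h, MulChar.sum_one_eq_card_units, Fintype.card_units,
      Nat.cast_sub Fintype.card_pos, Nat.cast_one, mul_one]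
  · rw [MulChar.sum_eq_zero_of_ne_one h, mul_zero]

omit [DecidableEq F] in
/-- The sum defining `₂F₁(A, ε; C; x)`, including its `y = 0` term, is a Jacobi sum. -/
theorem sum_mulChar_one_sub_mul_inv (A C : MulChar F ℂ) {x : F} (hx : x ≠ 0) (hx1 : 1 - x ≠ 0) :
    ∑ y : F, C (1 - y) * A⁻¹ (1 - x * y) =
      C (-1) * C⁻¹ x * (A⁻¹ * C) (1 - x) * J C A⁻¹ := by
  have hc : (1 - x) * x⁻¹ ≠ 0 := mul_ne_zero hx1 (inv_ne_zero hx)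
  rw [← ((Equiv.mulLeft₀ _ hc).trans (Equiv.addLeft 1)).sum_comp, J, mul_sum]
  refine sum_congr rfl fun u _ => ?_
  have h₁ : 1 - (1 + (1 - x) * x⁻¹ * u) = -1 * x⁻¹ * (1 - x) * u := by ring
  have h₂ : 1 - x * (1 + (1 - x) * x⁻¹ * u) = (1 - x) * (1 - u) := by field_simp; ring
  simp only [Equiv.trans_apply, Equiv.mulLeft₀_apply, Equiv.coe_addLeft, h₁, h₂, map_mul,
    MulChar.mul_apply, MulChar.inv_apply' C]
  ring

theorem twoF1_one_eq_sum (A C : MulChar F ℂ) (x : F) :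
    twoF1 A 1 C x =
      (1 : MulChar F ℂ) x * C (-1) * (∑ y : F, C (1 - y) * A⁻¹ (1 - x * y) - 1) := by
  have h : ∑ y : F, (1 : MulChar F ℂ) y * C (1 - y) * A⁻¹ (1 - x * y) =
      ∑ y : F, C (1 - y) * A⁻¹ (1 - x * y) - 1 := by
    rw [eq_sub_iff_add_eq, Fintype.sum_eq_add_sum_compl 0,
      Fintype.sum_eq_add_sum_compl (0 : F) fun y => C (1 - y) * _]
    have : ∑ y ∈ ({0}ᶜ : Finset F), (1 : MulChar F ℂ) y * C (1 - y) * A⁻¹ (1 - x * y) =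
        ∑ y ∈ ({0}ᶜ : Finset F), C (1 - y) * A⁻¹ (1 - x * y) := by
      refine sum_congr rfl fun y hy => ?_
      rw [MulChar.one_apply (isUnit_iff_ne_zero.2 (by simpa using hy)), one_mul]
    rw [this]
    simp [add_comm, MulChar.map_zero]
  rw [twoF1, inv_one, one_mul, h]

/-- Reduction of `₂F₁(A, ε; C; x)`. -/
theorem twoF1_second_trivial (A C : MulChar F ℂ) (x : F) :
    twoF1 A (1 : MulChar F ℂ) C x =
      binom C A * A (-1) * C⁻¹ x * (A⁻¹ * C) (1 - x)
      - C (-1) * (1 : MulChar F ℂ) x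
      + ((Fintype.card F : ℂ) - 1) * A (-1) * δ (1 - x) * δchar (A⁻¹ * C) := by
  rw [twoF1_one_eq_sum]
  rcases eq_or_ne x 0 with rfl | hx
  · simp [δ, MulChar.map_zero]
  rw [MulChar.one_apply (isUnit_iff_ne_zero.2 hx)]
  rcases eq_or_ne (1 - x) 0 with hx1 | hx1
  · obtain rfl : x = 1 := (sub_eq_zero.1 hx1).symm
    have hsum : ∑ y : F, C (1 - y) * A⁻¹ (1 - 1 * y) =
        ((Fintype.card F : ℂ) - 1) * δchar (A⁻¹ * C) := by
      rw [← mulChar_sum_eq_δchar, ← (Equiv.subLeft (1 : F)).sum_comp]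
      refine sum_congr rfl fun y _ => ?_
      simp [mul_comm]
    have hAC : C (-1) * δchar (A⁻¹ * C) = A (-1) * δchar (A⁻¹ * C) := by
      unfold δchar
      split_ifs with h
      · rw [inv_mul_eq_one.1 h]
      · simp
    rw [hsum, sub_self, MulChar.map_zero, δ, if_pos rfl]
    linear_combination ((Fintype.card F : ℂ) - 1) * hAC
  · rw [sum_mulChar_one_sub_mul_inv A C hx hx1, δ, if_neg hx1, binom]
    linear_combination C⁻¹ x * (A⁻¹ * C) (1 - x) * J C A⁻¹ *
      (mulChar_neg_one_mul_self C - mulChar_neg_one_mul_self A)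

end FFAppell
end

section
/- For any multiplicative characters A, B of F_q and any x ∈ F_q, one has ₂F₁(A, B; A; x) = binom(B, A)·ε(x)·B̄(1−x) − Ā(−x) + (q−1)·A(−1)·δ(1−x)·δ(B). -/
open Finset

namespace FFAppell

variable {F : Type*} [Field F] [Fintype F] [DecidableEq F]

lemma sum_mul_inv_one_sub (B : MulChar F ℂ) :
    ∑ y : F, B y * B⁻¹ (1 - y) =
      -B (-1) + ((Fintype.card F : ℂ) - 1) * δchar B := by
  by_cases hB : B = 1
  · subst hB
    have h : jacobiSum (1 : MulChar F ℂ) 1 = Fintype.card F - 2 := jacobiSum_trivial_trivial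
    rw [jacobiSum] at h
    rw [inv_one, h, MulChar.one_apply (isUnit_one.neg)]
    simp only [δchar, if_true]
    ring
  · have h := jacobiSum_nontrivial_inv hB
    rw [jacobiSum] at h
    simp [h, δchar, hB]

/-- The substitution `u = -(1 - x) y / (1 - y)` in the Jacobi sum `J(B, Ā)`; it misses the
value `u = 1 - x`. -/
lemma J_inv_eq_sum_add (A B : MulChar F ℂ) {x : F} (hx : x ≠ 1) :
    J B A⁻¹ =
      B (-1) * B (1 - x) * ∑ y : F, B y * (B⁻¹ * A) (1 - y) * A⁻¹ (1 - x * y)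
        + B (1 - x) * A⁻¹ x := by
  have hx' : 1 - x ≠ 0 := sub_ne_zero.mpr hx.symm
  have hterm : ∀ y : F, y ≠ 1 →
      B (-(1 - x) * y / (1 - y)) * A⁻¹ (1 - -(1 - x) * y / (1 - y)) =
        B (-1) * B (1 - x) * (B y * (B⁻¹ * A) (1 - y) * A⁻¹ (1 - x * y)) := by
    intro y hy
    have hy' : 1 - y ≠ 0 := sub_ne_zero.mpr hy.symm
    have h₁ : -(1 - x) * y / (1 - y) = -1 * (1 - x) * y * (1 - y)⁻¹ := by ring
    have h₂ : 1 - -(1 - x) * y / (1 - y) = (1 - x * y) * (1 - y)⁻¹ := by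
      field_simp
      ring
    rw [h₂, h₁]
    simp only [map_mul, MulChar.coeToFun_mul, Pi.mul_apply, MulChar.inv_apply', inv_inv]
    ring
  have herase : ∑ y : F, B y * (B⁻¹ * A) (1 - y) * A⁻¹ (1 - x * y) =
      ∑ y ∈ univ.erase 1, B y * (B⁻¹ * A) (1 - y) * A⁻¹ (1 - x * y) :=
    (sum_erase univ (by simp [MulChar.map_zero])).symm
  rw [J, ← sum_erase_add _ _ (mem_univ (1 - x)), herase, mul_sum, sub_sub_cancel]
  congr 1
  symm
  refine sum_bij' (fun y _ ↦ -(1 - x) * y / (1 - y)) (fun u _ ↦ u / (u - (1 - x)))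
    ?_ ?_ ?_ ?_ ?_
  · intro y hy
    have hy' : 1 - y ≠ 0 := sub_ne_zero.mpr (ne_of_mem_erase hy).symm
    refine mem_erase.mpr ⟨fun h ↦ hx' ?_, mem_univ _⟩
    rw [div_eq_iff hy'] at h
    linear_combination -h
  · intro u hu
    have hu' : u - (1 - x) ≠ 0 := sub_ne_zero.mpr (ne_of_mem_erase hu)
    refine mem_erase.mpr ⟨fun h ↦ hx' ?_, mem_univ _⟩
    rw [div_eq_iff hu'] at h
    linear_combination h
  · intro y hy
    have hy' : 1 - y ≠ 0 := sub_ne_zero.mpr (ne_of_mem_erase hy).symm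
    have h : -(1 - x) * y / (1 - y) - (1 - x) = -(1 - x) / (1 - y) := by
      field_simp
      ring
    simp only [h]
    field_simp
  · intro u hu
    have hu' : u - (1 - x) ≠ 0 := sub_ne_zero.mpr (ne_of_mem_erase hu)
    have h : 1 - u / (u - (1 - x)) = -(1 - x) / (u - (1 - x)) := by
      field_simp
      ring
    simp only [h]
    field_simp
  · exact fun y hy ↦ (hterm y (ne_of_mem_erase hy)).symm

/-- Reduction of `₂F₁(A, B; A; x)`. -/
theorem twoF1_top_eq_bottom (A B : MulChar F ℂ) (x : F) :
    twoF1 A B A x =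
      binom B A * (1 : MulChar F ℂ) x * B⁻¹ (1 - x)
      - A⁻¹ (-x)
      + ((Fintype.card F : ℂ) - 1) * A (-1) * δ (1 - x) * δchar B := by
  have hsq (χ : MulChar F ℂ) : χ (-1) * χ (-1) = 1 := by rw [← map_mul]; simp
  rcases eq_or_ne x 0 with rfl | hx0
  · simp [twoF1, δ, MulChar.map_zero]
  have hε : (1 : MulChar F ℂ) x = 1 := MulChar.one_apply hx0.isUnit
  have hneg : A⁻¹ (-x) = A (-1) * A⁻¹ x := by
    rw [← neg_one_mul, map_mul, MulChar.inv_apply' A (-1), inv_neg_one]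
  rcases eq_or_ne x 1 with rfl | hx1
  · have hsum : ∑ y : F, B y * (B⁻¹ * A) (1 - y) * A⁻¹ (1 - 1 * y) =
        ∑ y : F, B y * B⁻¹ (1 - y) := by
      refine sum_congr rfl fun y _ ↦ ?_
      rcases eq_or_ne (1 - y) 0 with h | h
      · simp [h, MulChar.map_zero]
      · have hA : A (1 - y) * A⁻¹ (1 - y) = 1 := by
          rw [MulChar.inv_apply', ← map_mul, mul_inv_cancel₀ h, map_one]
        rw [one_mul, MulChar.mul_apply]
        linear_combination B y * B⁻¹ (1 - y) * hA
    rw [twoF1, hsum, sum_mul_inv_one_sub, hneg, hε, MulChar.mul_apply, sub_self, MulChar.map_zero,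
      map_one]
    by_cases hB : B = 1
    · subst hB
      simp only [δ, δchar, if_true, MulChar.one_apply isUnit_one.neg]
      ring
    · simp only [δ, δchar, hB, if_true, if_false]
      linear_combination -A (-1) * hsq B
  · have hx' : 1 - x ≠ 0 := sub_ne_zero.mpr hx1.symm
    have hB : B (1 - x) * B⁻¹ (1 - x) = 1 := by
      rw [MulChar.inv_apply', ← map_mul, mul_inv_cancel₀ hx', map_one]
    rw [twoF1, binom, J_inv_eq_sum_add A B hx1, hneg, hε, MulChar.mul_apply, δ, if_neg hx']
    linear_combination (-(A (-1) * B (-1) *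
      ∑ y : F, B y * (B⁻¹ * A) (1 - y) * A⁻¹ (1 - x * y)) - A (-1) * A⁻¹ x) * hB

end FFAppell
end
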